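/- General unlimited-assistance converse for CS-SRA(N,K,N_B,K_B) with K ≥ N/2: any feasible scheme satisfying the decodability and security constraints must have λ₀ ≤ N − (N−K)·N_B/K_B. -/

import Mathlib

open scoped Classical in
/-- Probability that the random variable `X` takes value `s`, under the (finite) probability
mass function `p` on the sample space `Ω`. -/
noncomputable def pmfOf {Ω S : Type*} [Fintype Ω] (p : Ω → ℝ) (X : Ω → S) (s : S) : ℝ :=
  ∑ ω : Ω, if X ω = s then p ω else 0

/-- Shannon entropy (in nats) of the random variable `X` under `p`. -/
noncomputable def Hent {Ω S : Type*} [Fintype Ω] [Fintype S] (p : Ω → ℝ) (X : Ω → S) : ℝ :=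
  -∑ s : S, pmfOf p X s * Real.log (pmfOf p X s)

/-- Conditional entropy `H(X | Z)`. -/
noncomputable def condH {Ω S U : Type*} [Fintype Ω] [Fintype S] [Fintype U]
    (p : Ω → ℝ) (X : Ω → S) (Z : Ω → U) : ℝ :=
  Hent p (fun ω => (X ω, Z ω)) - Hent p Z

/-- Mutual information `I(X ; Y)`. -/
noncomputable def MI {Ω S T : Type*} [Fintype Ω] [Fintype S] [Fintype T]
    (p : Ω → ℝ) (X : Ω → S) (Y : Ω → T) : ℝ :=
  Hent p X + Hent p Y - Hent p (fun ω => (X ω, Y ω))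

/-- Conditional mutual information `I(X ; Y | Z)`. -/
noncomputable def CMI {Ω S T U : Type*} [Fintype Ω] [Fintype S] [Fintype T] [Fintype U]
    (p : Ω → ℝ) (X : Ω → S) (Y : Ω → T) (Z : Ω → U) : ℝ :=
  Hent p (fun ω => (X ω, Z ω)) + Hent p (fun ω => (Y ω, Z ω))
    - Hent p (fun ω => (X ω, Y ω, Z ω)) - Hent p Z

section Polymatroid

variable {ι : Type*} [DecidableEq ι]

/-- A normalized, monotone, submodular set function. -/
structure IsPolymatroid (F : Finset ι → ℝ) : Prop where
  empty : F ∅ = 0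
  mono : ∀ s t, s ⊆ t → F s ≤ F t
  submod : ∀ s t, F (s ∪ t) + F (s ∩ t) ≤ F s + F t

theorem IsPolymatroid.union_le {F : Finset ι → ℝ} (hF : IsPolymatroid F) (s t : Finset ι) :
    F (s ∪ t) ≤ F s + ∑ i ∈ t, F {i} := by
  induction t using Finset.induction_on with
  | empty => simp
  | insert a t ha ih =>
    have h1 := hF.submod (s ∪ t) {a}
    have h2 := hF.mono ∅ ((s ∪ t) ∩ {a}) (Finset.empty_subset _)
    have h3 : s ∪ insert a t = s ∪ t ∪ {a} := by ext; simp
    rw [Finset.sum_insert ha, h3]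
    linarith [hF.empty]

/-- The greedy increments along an enumeration of `A` sum to the total increment over `A`, and
bound the increment over each subset of `A` from below. -/
theorem IsPolymatroid.exists_increments {F : Finset ι → ℝ} (hF : IsPolymatroid F)
    (W A : Finset ι) :
    ∃ e : ι → ℝ, ∑ i ∈ A, e i = F (W ∪ A) - F W ∧
      ∀ T ⊆ A, ∑ i ∈ T, e i ≤ F (W ∪ T) - F W := by
  induction A using Finset.induction_on with
  | empty => exact ⟨0, by simp, fun T hT => by simp [Finset.subset_empty.1 hT]⟩
  | insert a A ha ih =>
    obtain ⟨e, he, hT⟩ := ih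
    have agree : ∀ T ⊆ A, ∑ i ∈ T, Function.update e a (F (W ∪ insert a A) - F (W ∪ A)) i
        = ∑ i ∈ T, e i := fun T hTA => Finset.sum_congr rfl fun i hi => by
      rw [Function.update_of_ne]
      rintro rfl
      exact ha (hTA hi)
    refine ⟨Function.update e a (F (W ∪ insert a A) - F (W ∪ A)), ?_, fun T hTA => ?_⟩
    · rw [Finset.sum_insert ha, agree A subset_rfl, he, Function.update_self]
      ring
    · by_cases haT : a ∈ T
      · have hsub : T.erase a ⊆ A := by
          intro i hi
          rw [Finset.mem_erase] at hi
          exact (Finset.mem_insert.1 (hTA hi.2)).resolve_left hi.1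
        rw [← Finset.add_sum_erase _ _ haT, agree _ hsub, Function.update_self]
        have h1 := hT _ hsub
        have h2 := hF.submod (W ∪ T) (W ∪ A)
        have h3 : W ∪ T ∪ (W ∪ A) = W ∪ insert a A := by
          ext i
          have := @hsub i
          have hia : i = a → i ∈ T := by rintro rfl; exact haT
          simp only [Finset.mem_union, Finset.mem_insert, Finset.mem_erase] at this ⊢
          tauto
        have h4 : F (W ∪ T.erase a) ≤ F ((W ∪ T) ∩ (W ∪ A)) := by
          apply hF.mono
          intro i
          have := @hsub i
          simp only [Finset.mem_union, Finset.mem_inter, Finset.mem_erase] at this ⊢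
          tauto
        rw [h3] at h2
        linarith
      · have hsub : T ⊆ A := (Finset.subset_insert_iff_of_notMem haT).1 hTA
        rw [agree _ hsub]
        exact hT _ hsub

/-- Some `m`-element subset has average at most the overall average. -/
theorem Finset.exists_subset_card_mul_sum_le (d : ι → ℝ) (A : Finset ι) (m : ℕ)
    (hm : m ≤ A.card) :
    ∃ T ⊆ A, T.card = m ∧ (A.card : ℝ) * ∑ i ∈ T, d i ≤ m * ∑ i ∈ A, d i := by
  induction hk : A.card - m generalizing m with
  | zero =>
    obtain rfl : m = A.card := by omega
    exact ⟨A, subset_rfl, rfl, le_rfl⟩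
  | succ k ih =>
    obtain ⟨T, hTA, hT, hle⟩ := ih (m + 1) (by omega) (by omega)
    have hne : T.Nonempty := Finset.card_pos.1 (by omega)
    obtain ⟨a, ha, hmax⟩ := T.exists_max_image d hne
    refine ⟨T.erase a, (Finset.erase_subset _ _).trans hTA, by
      rw [Finset.card_erase_of_mem ha, hT]; rfl, ?_⟩
    have h1 : ∑ i ∈ T, d i ≤ (m + 1) * d a := by
      have := Finset.sum_le_card_nsmul T d (d a) hmax
      rw [hT] at this
      simpa using this
    rw [← Finset.add_sum_erase _ _ ha] at h1 hle
    push_cast at hle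
    have hpos : (0 : ℝ) < m + 1 := by positivity
    have h2 : ∑ i ∈ T.erase a, d i ≤ m * d a := by linarith
    have h3 := mul_le_mul_of_nonneg_left h2 (Nat.cast_nonneg (α := ℝ) A.card)
    have h4 := mul_le_mul_of_nonneg_left hle (Nat.cast_nonneg (α := ℝ) m)
    refine le_of_mul_le_mul_left ?_ hpos
    linarith

/-- The converse bound for an abstract polymatroid: `a` is the message, `E` the intercepted
nodes, `R` the remaining decoding nodes, `W` the intercepted randomness, and `A` the remaining
randomness, any `m` components of which complete `W` to a decoding set. -/
theorem IsPolymatroid.converse {F : Finset ι → ℝ} (hF : IsPolymatroid F) (a : ι)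
    (E R W A : Finset ι) (m : ℕ) (hm : m ≤ A.card) (L : ℝ)
    (hind : F {a} + (∑ i ∈ W, F {i} + ∑ i ∈ A, F {i}) ≤ F (insert a (W ∪ A)))
    (hsec : F {a} + F (E ∪ W) ≤ F (insert a (E ∪ W)))
    (hdec : ∀ T ⊆ A, T.card = m →
      F (insert a (E ∪ R ∪ (W ∪ T))) ≤ F (E ∪ R ∪ (W ∪ T)))
    (hE : ∀ i ∈ E, F {i} ≤ L) (hR : ∀ i ∈ R, F {i} ≤ L) :
    A.card * F {a} ≤ A.card * (R.card * L) + m * (E.card * L) := by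
  obtain ⟨e, he, heT⟩ := hF.exists_increments (insert a (E ∪ W)) A
  obtain ⟨T, hTA, hT, hle⟩ :=
    Finset.exists_subset_card_mul_sum_le (fun i => F {i} - e i) A m hm
  have hEs : ∑ i ∈ E, F {i} ≤ E.card * L := by
    simpa using Finset.sum_le_card_nsmul E _ L hE
  have hRs : ∑ i ∈ R, F {i} ≤ R.card * L := by
    simpa using Finset.sum_le_card_nsmul R _ L hR
  have h1 := hdec T hTA hT
  have h2 : F (E ∪ R ∪ (W ∪ T)) ≤ F (E ∪ W) + ∑ i ∈ T, F {i} + ∑ i ∈ R, F {i} := by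
    have : E ∪ R ∪ (W ∪ T) = E ∪ W ∪ T ∪ R := by ext; simp; tauto
    rw [this]
    linarith [hF.union_le (E ∪ W ∪ T) R, hF.union_le (E ∪ W) T]
  have h3 : F (insert a (E ∪ W) ∪ T) ≤ F (insert a (E ∪ R ∪ (W ∪ T))) := by
    apply hF.mono
    intro i
    simp only [Finset.mem_union, Finset.mem_insert]
    tauto
  have h4 := heT T hTA
  have h5 : F (insert a (W ∪ A)) ≤ F (insert a (E ∪ W) ∪ A) := by
    apply hF.mono
    intro i
    simp only [Finset.mem_union, Finset.mem_insert]
    tauto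
  have h6 : F (insert a (E ∪ W)) ≤ F {a} + ∑ i ∈ W, F {i} + ∑ i ∈ E, F {i} := by
    have : insert a (E ∪ W) = {a} ∪ W ∪ E := by ext; simp; tauto
    rw [this]
    linarith [hF.union_le ({a} ∪ W) E, hF.union_le {a} W]
  simp only [Finset.sum_sub_distrib] at hle
  have h7 : F {a} ≤ R.card * L + (∑ i ∈ T, F {i} - ∑ i ∈ T, e i) := by linarith
  have h8 : ∑ i ∈ A, F {i} - ∑ i ∈ A, e i ≤ E.card * L := by linarith
  have h9 := mul_le_mul_of_nonneg_left h7 (Nat.cast_nonneg (α := ℝ) A.card)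
  have h10 := mul_le_mul_of_nonneg_left h8 (Nat.cast_nonneg (α := ℝ) m)
  linarith

end Polymatroid

section Entropy

variable {Ω S T U : Type*} [Fintype Ω] {p : Ω → ℝ}

theorem pmfOf_nonneg (hp0 : ∀ ω, 0 ≤ p ω) (X : Ω → S) (s : S) : 0 ≤ pmfOf p X s :=
  Finset.sum_nonneg fun ω _ => by split_ifs <;> simp [hp0]

theorem sum_mul_comp [Fintype S] (p : Ω → ℝ) (X : Ω → S) (g : S → ℝ) :
    ∑ ω, p ω * g (X ω) = ∑ s, pmfOf p X s * g s := by
  classical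
  simp only [pmfOf, Finset.sum_mul, ite_mul, zero_mul]
  rw [Finset.sum_comm]
  simp

theorem sum_pmfOf [Fintype S] (p : Ω → ℝ) (X : Ω → S) : ∑ s, pmfOf p X s = ∑ ω, p ω := by
  simpa using (sum_mul_comp p X fun _ => 1).symm

theorem sum_pmfOf_prod [Fintype S] (p : Ω → ℝ) (X : Ω → S) (Z : Ω → T) (z : T) :
    ∑ x, pmfOf p (fun ω => (X ω, Z ω)) (x, z) = pmfOf p Z z := by
  classical
  simp only [pmfOf, Prod.mk.injEq]
  rw [Finset.sum_comm]
  refine Finset.sum_congr rfl fun ω _ => ?_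
  simp [ite_and]

theorem Hent_eq_sum [Fintype S] (p : Ω → ℝ) (X : Ω → S) :
    Hent p X = -∑ ω, p ω * Real.log (pmfOf p X (X ω)) := by
  rw [sum_mul_comp p X fun s => Real.log (pmfOf p X s), Hent]

theorem le_pmfOf_self (hp0 : ∀ ω, 0 ≤ p ω) (X : Ω → S) (ω : Ω) : p ω ≤ pmfOf p X (X ω) := by
  classical
  have := Finset.single_le_sum (f := fun ω' => if X ω' = X ω then p ω' else 0)
    (fun ω' _ => by split_ifs <;> simp [hp0]) (Finset.mem_univ ω)
  simpa [pmfOf] using this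

/-- A random variable determined by another one has smaller entropy. -/
theorem Hent_le_of_determined [Fintype S] [Fintype T] (hp0 : ∀ ω, 0 ≤ p ω) (X : Ω → S) (Z : Ω → T)
    (h : ∀ ω ω', Z ω = Z ω' → X ω = X ω') : Hent p X ≤ Hent p Z := by
  classical
  rw [Hent_eq_sum, Hent_eq_sum, neg_le_neg_iff]
  refine Finset.sum_le_sum fun ω _ => ?_
  rcases (hp0 ω).eq_or_lt with h0 | hpos
  · simp [← h0]
  refine mul_le_mul_of_nonneg_left
    (Real.log_le_log (hpos.trans_le (le_pmfOf_self hp0 Z ω)) ?_) (hp0 ω)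
  refine Finset.sum_le_sum fun ω' _ => ?_
  by_cases hZ : Z ω' = Z ω
  · simp [hZ, h _ _ hZ]
  · rw [if_neg hZ]
    split_ifs <;> simp [hp0]

theorem Hent_congr [Fintype S] [Fintype T] (hp0 : ∀ ω, 0 ≤ p ω) {X : Ω → S} {Z : Ω → T}
    (h : ∀ ω ω', X ω = X ω' ↔ Z ω = Z ω') : Hent p X = Hent p Z :=
  le_antisymm (Hent_le_of_determined hp0 X Z fun ω ω' => (h ω ω').2)
    (Hent_le_of_determined hp0 Z X fun ω ω' => (h ω ω').1)

theorem Hent_submodular [Fintype S] [Fintype T] [Fintype U]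
    (hp0 : ∀ ω, 0 ≤ p ω) (hp1 : ∑ ω, p ω = 1)
    (X : Ω → S) (Y : Ω → T) (Z : Ω → U) :
    Hent p (fun ω => (X ω, Y ω, Z ω)) + Hent p Z
      ≤ Hent p (fun ω => (X ω, Z ω)) + Hent p (fun ω => (Y ω, Z ω)) := by
  set PXYZ := pmfOf p (fun ω => (X ω, Y ω, Z ω)) with hXYZ
  set PXZ := pmfOf p (fun ω => (X ω, Z ω)) with hXZ
  set PYZ := pmfOf p (fun ω => (Y ω, Z ω)) with hYZ
  set PZ := pmfOf p Z with hZ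
  have hratio : ∑ ω, p ω * (PXZ (X ω, Z ω) * PYZ (Y ω, Z ω)
      / (PXYZ (X ω, Y ω, Z ω) * PZ (Z ω))) ≤ 1 := by
    rw [sum_mul_comp p (fun ω => (X ω, Y ω, Z ω))
      (fun s => PXZ (s.1, s.2.2) * PYZ (s.2.1, s.2.2) / (PXYZ s * PZ s.2.2))]
    calc _ ≤ ∑ s : S × T × U, PXZ (s.1, s.2.2) * PYZ (s.2.1, s.2.2) / PZ s.2.2 := by
          refine Finset.sum_le_sum fun s _ => ?_
          have hn : 0 ≤ PXZ (s.1, s.2.2) * PYZ (s.2.1, s.2.2) / PZ s.2.2 :=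
            div_nonneg (mul_nonneg (pmfOf_nonneg hp0 _ _) (pmfOf_nonneg hp0 _ _))
              (pmfOf_nonneg hp0 _ _)
          rw [← hXYZ]
          by_cases h0 : PXYZ s = 0
          · simpa [h0] using hn
          · rw [mul_comm (PXYZ s) (PZ _), ← div_div, mul_div_cancel₀ _ h0]
      _ = ∑ z, ∑ y, ∑ x, PXZ (x, z) * PYZ (y, z) / PZ z := by
          rw [Fintype.sum_prod_type_right, Fintype.sum_prod_type_right]
      _ = ∑ z, PZ z := by
          refine Finset.sum_congr rfl fun z _ => ?_
          simp only [← Finset.sum_div, ← Finset.sum_mul, ← Finset.mul_sum]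
          rw [hXZ, hYZ, sum_pmfOf_prod, sum_pmfOf_prod, ← hZ, mul_self_div_self]
      _ = 1 := by rw [hZ, sum_pmfOf, hp1]
  have hlog : ∀ ω, p ω * (Real.log (PXZ (X ω, Z ω)) + Real.log (PYZ (Y ω, Z ω))
      - Real.log (PXYZ (X ω, Y ω, Z ω)) - Real.log (PZ (Z ω)))
      ≤ p ω * (PXZ (X ω, Z ω) * PYZ (Y ω, Z ω)
      / (PXYZ (X ω, Y ω, Z ω) * PZ (Z ω))) - p ω := by
    intro ω
    rcases (hp0 ω).eq_or_lt with h0 | hpos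
    · simp [← h0]
    have h1 := hpos.trans_le (le_pmfOf_self hp0 (fun ω => (X ω, Z ω)) ω)
    have h2 := hpos.trans_le (le_pmfOf_self hp0 (fun ω => (Y ω, Z ω)) ω)
    have h3 := hpos.trans_le (le_pmfOf_self hp0 (fun ω => (X ω, Y ω, Z ω)) ω)
    have h4 := hpos.trans_le (le_pmfOf_self hp0 Z ω)
    have h5 := Real.log_le_sub_one_of_pos (div_pos (mul_pos h1 h2) (mul_pos h3 h4))
    rw [Real.log_div (mul_pos h1 h2).ne' (mul_pos h3 h4).ne', Real.log_mul h1.ne' h2.ne',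
      Real.log_mul h3.ne' h4.ne'] at h5
    rw [← mul_sub_one]
    refine mul_le_mul_of_nonneg_left ?_ (hp0 ω)
    linarith
  have hsum := Finset.sum_le_sum fun ω (_ : ω ∈ Finset.univ) => hlog ω
  simp only [Finset.sum_sub_distrib, mul_sub, mul_add, Finset.sum_add_distrib] at hsum
  rw [Hent_eq_sum, Hent_eq_sum, Hent_eq_sum, Hent_eq_sum]
  linarith

/-- The joint entropies of a finite family of random variables form a polymatroid. -/
theorem isPolymatroid_Hent {ι : Type*} [DecidableEq ι] [Fintype S] (hp0 : ∀ ω, 0 ≤ p ω)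
    (hp1 : ∑ ω, p ω = 1) (V : ι → Ω → S) :
    IsPolymatroid fun s : Finset ι => Hent p fun ω (i : s) => V i ω where
  empty := by simp [Hent_eq_sum, pmfOf, hp1, eq_iff_true_of_subsingleton]
  mono s t hst := Hent_le_of_determined hp0 _ _ fun ω ω' h => by
    simp only [funext_iff, Subtype.forall] at h ⊢
    exact fun i hi => h i (hst hi)
  submod s t := by
    have h := Hent_submodular hp0 hp1 (fun ω (i : s) => V i ω) (fun ω (i : t) => V i ω)
      (fun ω (i : ↥(s ∩ t)) => V i ω)
    convert h using 2
    all_goals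
      refine Hent_congr hp0 fun ω ω' => ?_
      simp only [Prod.mk.injEq, funext_iff, Subtype.forall, Finset.mem_union, Finset.mem_inter]
      grind

/-- Entropy is additive on independent families. -/
theorem Hent_prod_eq_of_indep {β : Type*} [Fintype β] [DecidableEq β] [Fintype S] [Fintype T]
    (hp0 : ∀ ω, 0 ≤ p ω)
    (X : Ω → S) (B : β → Ω → T)
    (hindep : ∀ (y : S) (b : β → T),
      pmfOf p (fun ω => (X ω, fun i => B i ω)) (y, b)
        = pmfOf p X y * ∏ i, pmfOf p (fun ω => B i ω) (b i)) :
    Hent p (fun ω => (X ω, fun i => B i ω)) = Hent p X + ∑ i, Hent p (B i) := by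
  simp only [Hent_eq_sum, hindep]
  rw [Finset.sum_neg_distrib, ← neg_add, Finset.sum_comm, ← Finset.sum_add_distrib]
  congr 1
  refine Finset.sum_congr rfl fun ω _ => ?_
  rcases (hp0 ω).eq_or_lt with h0 | hpos
  · simp [← h0]
  have hB : ∀ i, pmfOf p (B i) (B i ω) ≠ 0 := fun i =>
    (hpos.trans_le (le_pmfOf_self hp0 (B i) ω)).ne'
  rw [Real.log_mul (hpos.trans_le (le_pmfOf_self hp0 X ω)).ne'
    (Finset.prod_ne_zero_iff.2 fun i _ => hB i), Real.log_prod fun i _ => hB i, mul_add,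
    Finset.mul_sum]

end Entropy

/-- General unlimited-assistance converse for `CS-SRA(N, K, N_B, K_B)` with `K ≥ N/2` and
`K_B > N_B/2`: any feasible scheme (uniform message of entropy `κλ₀ log q`, storage nodes
of entropy at most `κ log q`, mutually independent SR components independent of the message,
decodability and security for all decoding sets) must have `λ₀ ≤ N − (N−K)·N_B/K_B`. -/
theorem cssra_unlimited_converse
    {Ω M YT BT : Type*} [Fintype Ω] [Fintype M] [Fintype YT] [Fintype BT]
    (N K NB KB : ℕ) (hKN : K ≤ N) (hNK : N ≤ 2 * K) (hKB : KB ≤ NB) (hNB : NB < 2 * KB)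
    (p : Ω → ℝ) (hp0 : ∀ ω, 0 ≤ p ω) (hp1 : ∑ ω, p ω = 1)
    (Y0 : Ω → M) (Y : Fin N → Ω → YT) (B : Fin NB → Ω → BT)
    (q κ lam0 : ℝ) (hq : 1 < q) (hκ : 0 < κ)
    (hunif : ∀ y : M, pmfOf p Y0 y = 1 / (Fintype.card M : ℝ))
    (hH0 : Hent p Y0 = κ * lam0 * Real.log q)
    (hHY : ∀ n : Fin N, Hent p (Y n) ≤ κ * Real.log q)
    (hindep : ∀ (y : M) (b : Fin NB → BT),
      pmfOf p (fun ω => (Y0 ω, fun i => B i ω)) (y, b)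
        = pmfOf p Y0 y * ∏ i : Fin NB, pmfOf p (fun ω => B i ω) (b i))
    (hdec : ∀ (𝒦 : Finset (Fin N)) (𝒦B : Finset (Fin NB)), 𝒦.card = K → 𝒦B.card = KB →
      condH p Y0 (fun ω => ((fun n : ↥𝒦 => Y n ω), (fun i : ↥𝒦B => B i ω))) = 0)
    (hsec : ∀ (𝒦 : Finset (Fin N)) (𝒦B : Finset (Fin NB)), 𝒦.card = K → 𝒦B.card = KB →
      MI p Y0 (fun ω => ((fun n : ↥(𝒦ᶜ) => Y n ω), (fun i : ↥(𝒦Bᶜ) => B i ω))) = 0) :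
    lam0 ≤ (N : ℝ) - ((N : ℝ) - K) * NB / KB := by
  classical
  let V : Option (Fin N ⊕ Fin NB) → Ω → M ⊕ YT ⊕ BT := fun i ω =>
    match i with
    | none => .inl (Y0 ω)
    | some (.inl n) => .inr (.inl (Y n ω))
    | some (.inr j) => .inr (.inr (B j ω))
  let F : Finset (Option (Fin N ⊕ Fin NB)) → ℝ := fun s => Hent p fun ω (i : s) => V i ω
  have hF : IsPolymatroid F := isPolymatroid_Hent hp0 hp1 V
  let y : Fin N ↪ Option (Fin N ⊕ Fin NB) := Function.Embedding.inl.trans .some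
  let b : Fin NB ↪ Option (Fin N ⊕ Fin NB) := Function.Embedding.inr.trans .some
  have hFY0 : F {none} = Hent p Y0 := Hent_congr hp0 fun ω ω' => by
    simp [funext_iff, V]
  have hFY : ∀ n, F {y n} = Hent p (Y n) := fun n => Hent_congr hp0 fun ω ω' => by
    simp [funext_iff, V, y]
  have hFB : ∀ j, F {b j} = Hent p (B j) := fun j => Hent_congr hp0 fun ω ω' => by
    simp [funext_iff, V, b]
  have hFn : ∀ (E : Finset (Fin N)) (S : Finset (Fin NB)), F (E.map y ∪ S.map b)
      = Hent p (fun ω => ((fun n : E => Y n ω), (fun i : S => B i ω))) := fun E S =>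
    Hent_congr hp0 fun ω ω' => by
      simp [funext_iff, V, y, b, or_imp, forall_and]
  have hF0 : ∀ (E : Finset (Fin N)) (S : Finset (Fin NB)),
      F (insert none (E.map y ∪ S.map b))
      = Hent p (fun ω => (Y0 ω, (fun n : E => Y n ω), (fun i : S => B i ω))) := fun E S =>
    Hent_congr hp0 fun ω ω' => by
      simp [funext_iff, V, y, b, or_imp, forall_and]
  obtain ⟨𝒦, -, h𝒦⟩ := Finset.exists_subset_card_eq
    (s := (Finset.univ : Finset (Fin N))) (n := K) (by simpa using hKN)
  obtain ⟨A, -, hA⟩ := Finset.exists_subset_card_eq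
    (s := (Finset.univ : Finset (Fin NB))) (n := KB) (by simpa using hKB)
  have h𝒦c : 𝒦ᶜ.card = N - K := by rw [Finset.card_compl, h𝒦, Fintype.card_fin]
  have hAc : Aᶜ.card = NB - KB := by rw [Finset.card_compl, hA, Fintype.card_fin]
  obtain ⟨R, hR𝒦, hR⟩ := Finset.exists_subset_card_eq (s := 𝒦) (n := 2 * K - N) (by omega)
  have key := hF.converse none (𝒦ᶜ.map y) (R.map y) (Aᶜ.map b) (A.map b) (2 * KB - NB)
    (by rw [Finset.card_map]; omega) (κ * Real.log q)
    (by
      have hu : insert none (Aᶜ.map b ∪ A.map b)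
          = insert none ((∅ : Finset (Fin N)).map y ∪ Finset.univ.map b) := by
        rw [← Finset.map_union, Finset.union_comm Aᶜ, Finset.union_compl]; simp
      have hall : F (insert none ((∅ : Finset (Fin N)).map y ∪ Finset.univ.map b))
          = Hent p (fun ω => (Y0 ω, fun i => B i ω)) := Hent_congr hp0 fun ω ω' => by
        simp [funext_iff, V, b]
      rw [hu, hall, Hent_prod_eq_of_indep hp0 Y0 B hindep, Finset.sum_map, Finset.sum_map,
        Finset.sum_compl_add_sum, hFY0]
      simp only [hFB]
      exact le_rfl)
    (by
      have h := hsec 𝒦 A h𝒦 hA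
      rw [MI] at h
      rw [hFn, hF0, hFY0]
      linarith)
    (by
      intro T' hT' hcard
      obtain ⟨T, hTA, rfl⟩ := Finset.subset_map_iff.1 hT'
      rw [Finset.card_map] at hcard
      rw [← Finset.map_union, ← Finset.map_union]
      have hd1 : Disjoint 𝒦ᶜ R := disjoint_compl_left.mono_right hR𝒦
      have hd2 : Disjoint Aᶜ T := disjoint_compl_left.mono_right hTA
      have h := hdec (𝒦ᶜ ∪ R) (Aᶜ ∪ T)
        (by rw [Finset.card_union_of_disjoint hd1]; omega)
        (by rw [Finset.card_union_of_disjoint hd2]; omega)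
      rw [condH] at h
      rw [hFn, hF0]
      linarith)
    (by
      intro i hi
      obtain ⟨n, -, rfl⟩ := Finset.mem_map.1 hi
      exact (hFY n).trans_le (hHY n))
    (by
      intro i hi
      obtain ⟨n, -, rfl⟩ := Finset.mem_map.1 hi
      exact (hFY n).trans_le (hHY n))
  rw [Finset.card_map, Finset.card_map, Finset.card_map, hA, hR, h𝒦c, hFY0, hH0,
    Nat.cast_sub hNK, Nat.cast_sub hKN, Nat.cast_sub hNB.le] at key
  push_cast at key
  have hL : 0 < κ * Real.log q := mul_pos hκ (Real.log_pos hq)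
  have hKBpos : (0 : ℝ) < KB := by
    have : 0 < KB := by omega
    exact_mod_cast this
  have hmul : KB * lam0 ≤ KB * (2 * K - N) + (2 * KB - NB) * ((N : ℝ) - K) := by
    refine le_of_mul_le_mul_right ?_ hL
    linarith
  rw [le_sub_iff_add_le, ← le_sub_iff_add_le', div_le_iff₀ hKBpos]
  linarith
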